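/- Fix α > 0 and set α' := α + 1/2. There exists a finite constant A, depending only on α, such that |C_k / k!| ≤ A^k · k^{α'k} for all k ≥ 1, where the constants C_k satisfy C_1 = Γ(α−1/2)/√π and C_k = (1/4)·Σ_{j=1}^{k−1} binom(k,j) C_j C_{k−j} + k·C_{k−1}·Γ(kα+k/2−1)/Γ((k−1)α+k/2−1) for k ≥ 2. -/

import Mathlib

open scoped BigOperators

lemma aux_Gamma_prod (N : ℕ) (x : ℝ) (hx : 0 < x) :
    Real.Gamma (x + N) ≤ (x + N) ^ N * Real.Gamma x := by
  induction N with
  | zero => simp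
  | succ n ih =>
    have h1 : Real.Gamma (x + (n + 1 : ℕ)) = (x + n) * Real.Gamma (x + n) := by
      rw [← Real.Gamma_add_one (by positivity)]
      push_cast
      ring_nf
    have hg : 0 < Real.Gamma x := Real.Gamma_pos_of_pos hx
    rw [h1, pow_succ']
    push_cast
    calc (x + n) * Real.Gamma (x + n) ≤ (x + n) * ((x + n) ^ n * Real.Gamma x) := by gcongr
      _ ≤ (x + (n + 1)) * ((x + (n + 1)) ^ n * Real.Gamma x) := by gcongr <;> linarith
      _ = _ := by ring

lemma aux_Gamma_ratio (α : ℝ) (hα : 0 < α) (N : ℕ) (hN : α < N) (x : ℝ) (hx : 0 < x) :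
    Real.Gamma (x + α) ≤ (x + N) ^ α * Real.Gamma x := by
  have hN0 : (0 : ℝ) < N := hα.trans hN
  have hg : 0 < Real.Gamma x := Real.Gamma_pos_of_pos hx
  have ht : 0 < α / N := by positivity
  have ht1 : α / N < 1 := (div_lt_one hN0).2 hN
  have h := Real.Gamma_mul_add_mul_le_rpow_Gamma_mul_rpow_Gamma (s := x) (t := x + N)
    (a := 1 - α / N) (b := α / N) hx (by positivity) (by linarith) ht (by ring)
  have e : (1 - α / N) * x + α / N * (x + N) = x + α := by field_simp; ring
  rw [e] at h
  refine h.trans ?_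
  have hg2 : 0 < Real.Gamma (x + N) := Real.Gamma_pos_of_pos (by positivity)
  calc Real.Gamma x ^ (1 - α / N) * Real.Gamma (x + N) ^ (α / N)
      ≤ Real.Gamma x ^ (1 - α / N) * ((x + N) ^ N * Real.Gamma x) ^ (α / N) := by
        gcongr
        exact aux_Gamma_prod N x hx
    _ = (x + N) ^ α * (Real.Gamma x ^ (1 - α / N) * Real.Gamma x ^ (α / N)) := by
        rw [Real.mul_rpow (by positivity) hg.le, ← Real.rpow_natCast, ← Real.rpow_mul (by positivity)]
        have : (N : ℝ) * (α / N) = α := by field_simp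
        rw [this]; ring
    _ = _ := by
        rw [← Real.rpow_add hg]; simp

lemma aux_catalan_mono (n : ℕ) : catalan n ≤ catalan (n + 1) := by
  rw [catalan_succ']
  have := Finset.single_le_sum (s := Finset.HasAntidiagonal.antidiagonal n)
    (f := fun ij : ℕ × ℕ => catalan ij.1 * catalan ij.2) (fun _ _ => Nat.zero_le _)
    (a := (0, n)) (by simp)
  simpa using this

lemma aux_catalan_le (n : ℕ) : catalan n ≤ 4 ^ n := by
  rw [catalan_eq_centralBinom_div]
  refine (Nat.div_le_self _ _).trans ?_
  have h := Nat.choose_le_two_pow (2 * n) n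
  rw [pow_mul] at h
  exact h

lemma aux_main (α B M : ℝ) (hα : 0 < α) (c : ℕ → ℝ) (hB : 0 ≤ B) (hM : 2 * B ≤ M)
    (h1 : |c 1| ≤ M)
    (hrec : ∀ n : ℕ, |c (n + 2)| ≤ (1 / 4) * ∑ ij ∈ Finset.HasAntidiagonal.antidiagonal n,
      |c (ij.1 + 1)| * |c (ij.2 + 1)| + |c (n + 1)| * (B * ((n + 2 : ℕ) : ℝ) ^ α)) :
    ∀ n : ℕ, |c (n + 1)| ≤ M ^ (n + 1) * catalan n * ((n + 1).factorial : ℝ) ^ α := by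
  have hM0 : 0 ≤ M := by linarith
  intro n
  induction n using Nat.strong_induction_on with
  | _ n ih =>
  rcases n with _ | n
  · simpa using h1
  · refine (hrec n).trans ?_
    have hs : ∑ ij ∈ Finset.HasAntidiagonal.antidiagonal n, |c (ij.1 + 1)| * |c (ij.2 + 1)| ≤
        M ^ (n + 2) * catalan (n + 1) * ((n + 2).factorial : ℝ) ^ α := by
      rw [catalan_succ']
      push_cast
      rw [Finset.mul_sum, Finset.sum_mul]
      refine Finset.sum_le_sum ?_
      rintro ⟨i, j⟩ hij
      rw [Finset.HasAntidiagonal.mem_antidiagonal] at hij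
      simp only at hij ⊢
      have hi := ih i (by omega)
      have hj := ih j (by omega)
      have hf : ((i + 1).factorial : ℝ) * ((j + 1).factorial : ℝ) ≤ ((n + 2).factorial : ℝ) := by
        have := Nat.le_of_dvd (Nat.factorial_pos _) (Nat.factorial_mul_factorial_dvd_factorial_add (i + 1) (j + 1))
        rw [show i + 1 + (j + 1) = n + 2 by omega] at this
        exact_mod_cast this
      calc |c (i + 1)| * |c (j + 1)| ≤ (M ^ (i + 1) * catalan i * ((i + 1).factorial : ℝ) ^ α) *
            (M ^ (j + 1) * catalan j * ((j + 1).factorial : ℝ) ^ α) := by gcongr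
        _ = M ^ (n + 2) * (catalan i * catalan j) *
            (((i + 1).factorial : ℝ) * ((j + 1).factorial : ℝ)) ^ α := by
            rw [Real.mul_rpow (by positivity) (by positivity), ← hij]; ring
        _ ≤ _ := by gcongr
    have hn := ih n (by omega)
    have hc : (catalan n : ℝ) ≤ catalan (n + 1) := by exact_mod_cast aux_catalan_mono n
    have hl : |c (n + 1)| * (B * ((n + 2 : ℕ) : ℝ) ^ α) ≤
        (1 / 2) * (M ^ (n + 2) * catalan (n + 1) * ((n + 2).factorial : ℝ) ^ α) := by
      calc |c (n + 1)| * (B * ((n + 2 : ℕ) : ℝ) ^ α)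
          ≤ (M ^ (n + 1) * catalan n * ((n + 1).factorial : ℝ) ^ α) *
            ((M / 2) * ((n + 2 : ℕ) : ℝ) ^ α) := by gcongr; linarith
        _ = (1 / 2) * (M ^ (n + 2) * catalan n * ((n + 2).factorial : ℝ) ^ α) := by
            rw [Nat.factorial_succ (n + 1), Nat.cast_mul,
              Real.mul_rpow (by positivity) (by positivity)]
            ring
        _ ≤ _ := by gcongr
    have hp : 0 ≤ M ^ (n + 2) * catalan (n + 1) * ((n + 2).factorial : ℝ) ^ α := by positivity
    have : n + 1 + 1 = n + 2 := rfl
    rw [this]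
    linarith

theorem stmt_10 (α : ℝ) (hα : 0 < α) (C : ℕ → ℝ)
    (hC1 : C 1 = Real.Gamma (α - 1 / 2) / Real.sqrt Real.pi)
    (hCrec : ∀ k : ℕ, 2 ≤ k →
      C k = (1 / 4) * ∑ j ∈ Finset.Ico 1 k, (k.choose j : ℝ) * C j * C (k - j)
        + (k : ℝ) * C (k - 1) *
            (Real.Gamma ((k : ℝ) * α + (k : ℝ) / 2 - 1) /
              Real.Gamma (((k : ℝ) - 1) * α + (k : ℝ) / 2 - 1))) :
    ∃ A : ℝ, ∀ k : ℕ, 1 ≤ k →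
      |C k / (k.factorial : ℝ)| ≤ A ^ k * (k : ℝ) ^ ((α + 1 / 2) * (k : ℝ)) := by
  obtain ⟨N, hN⟩ := exists_nat_gt α
  set B : ℝ := (α + 1 / 2 + N) ^ α with hBdef
  have hB : 0 ≤ B := by positivity
  set c : ℕ → ℝ := fun k => C k / (k.factorial : ℝ) with hc
  set M : ℝ := 2 * B + |c 1| with hMdef
  have hM0 : 0 ≤ M := by positivity
  have hrec : ∀ n : ℕ, |c (n + 2)| ≤ (1 / 4) * ∑ ij ∈ Finset.HasAntidiagonal.antidiagonal n,
      |c (ij.1 + 1)| * |c (ij.2 + 1)| + |c (n + 1)| * (B * ((n + 2 : ℕ) : ℝ) ^ α) := by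
    intro n
    have h := hCrec (n + 2) (by omega)
    set R : ℝ := Real.Gamma (((n + 2 : ℕ) : ℝ) * α + ((n + 2 : ℕ) : ℝ) / 2 - 1) /
              Real.Gamma ((((n + 2 : ℕ) : ℝ) - 1) * α + ((n + 2 : ℕ) : ℝ) / 2 - 1) with hR
    have hRb : |R| ≤ B * ((n + 2 : ℕ) : ℝ) ^ α := by
      set x : ℝ := (((n + 2 : ℕ) : ℝ) - 1) * α + ((n + 2 : ℕ) : ℝ) / 2 - 1 with hxdef
      have hx' : x = (n + 1) * α + n / 2 := by rw [hxdef]; push_cast; ring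
      have hx : 0 < x := by rw [hx']; positivity
      have hxa : ((n + 2 : ℕ) : ℝ) * α + ((n + 2 : ℕ) : ℝ) / 2 - 1 = x + α := by
        rw [hxdef]; ring
      have hg : 0 < Real.Gamma x := Real.Gamma_pos_of_pos hx
      have hg2 : 0 < Real.Gamma (x + α) := Real.Gamma_pos_of_pos (by positivity)
      rw [hR, hxa, abs_of_pos (by positivity), div_le_iff₀ hg]
      refine (aux_Gamma_ratio α hα N hN x hx).trans ?_
      rw [hBdef, ← Real.mul_rpow (by positivity) (by positivity)]
      gcongr
      rw [hx']
      push_cast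
      have : (0 : ℝ) ≤ n * N := by positivity
      have : (0 : ℝ) ≤ N := by positivity
      nlinarith
    have hce : c (n + 2) = (1 / 4) * ∑ ij ∈ Finset.HasAntidiagonal.antidiagonal n,
        c (ij.1 + 1) * c (ij.2 + 1) + c (n + 1) * R := by
      have hfac : (((n + 2).factorial : ℕ) : ℝ) ≠ 0 := by positivity
      have hfac1 : (((n + 1).factorial : ℕ) : ℝ) ≠ 0 := by positivity
      have hsum : ∑ j ∈ Finset.Ico 1 (n + 2), ((n + 2).choose j : ℝ) * C j * C (n + 2 - j) =
          ((n + 2).factorial : ℝ) * ∑ ij ∈ Finset.HasAntidiagonal.antidiagonal n,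
            c (ij.1 + 1) * c (ij.2 + 1) := by
        rw [Finset.sum_Ico_eq_sum_range, Finset.Nat.sum_antidiagonal_eq_sum_range_succ_mk,
          Finset.mul_sum]
        refine Finset.sum_congr rfl ?_
        intro j hj
        have hj' : j ≤ n := by
          have := Finset.mem_range.1 hj
          omega
        have hch := Nat.choose_mul_factorial_mul_factorial (n := n + 2) (k := j + 1) (by omega)
        have e : n + 2 - (j + 1) = n - j + 1 := by omega
        rw [add_comm 1 j]
        rw [e] at hch ⊢
        have ha : (((j + 1).factorial : ℕ) : ℝ) ≠ 0 := by positivity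
        have hb : (((n - j + 1).factorial : ℕ) : ℝ) ≠ 0 := by positivity
        simp only [hc]
        rw [← hch]
        simp only [Nat.cast_mul]
        field_simp
      rw [hsum] at h
      simp only [hc]
      rw [h, show n + 2 - 1 = n + 1 from rfl]
      have e2 : (((n + 2).factorial : ℕ) : ℝ) = ((n + 2 : ℕ) : ℝ) * ((n + 1).factorial : ℝ) := by
        rw [Nat.factorial_succ (n + 1), Nat.cast_mul]
      have e3 : ((n + 2 : ℕ) : ℝ) ≠ 0 := by positivity
      rw [add_div]
      congr 1
      · rw [mul_left_comm, mul_div_cancel_left₀ _ hfac]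
      · rw [e2]; field_simp
    rw [hce]
    refine (abs_add_le _ _).trans ?_
    rw [abs_mul, abs_mul, abs_of_pos (by norm_num : (0 : ℝ) < 1 / 4)]
    gcongr
    refine (Finset.abs_sum_le_sum_abs _ _).trans (le_of_eq ?_)
    simp only [abs_mul]
  have key := aux_main α B M hα c hB (by rw [hMdef]; linarith [abs_nonneg (c 1)])
    (by rw [hMdef]; linarith) hrec
  refine ⟨4 * M, ?_⟩
  intro k hk
  obtain ⟨n, rfl⟩ : ∃ n, k = n + 1 := ⟨k - 1, by omega⟩
  refine (key n).trans ?_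
  have hk1 : (1 : ℝ) ≤ ((n + 1 : ℕ) : ℝ) := by exact_mod_cast hk
  have hcat : (catalan n : ℝ) ≤ 4 ^ (n + 1) := by
    have h1 : (catalan n : ℝ) ≤ 4 ^ n := by exact_mod_cast aux_catalan_le n
    exact h1.trans (pow_le_pow_right₀ (by norm_num) (by omega))
  have hfac : ((n + 1).factorial : ℝ) ^ α ≤
      ((n + 1 : ℕ) : ℝ) ^ ((α + 1 / 2) * ((n + 1 : ℕ) : ℝ)) := by
    have h1 : ((n + 1).factorial : ℝ) ≤ ((n + 1 : ℕ) : ℝ) ^ (n + 1) := by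
      exact_mod_cast Nat.factorial_le_pow (n + 1)
    calc ((n + 1).factorial : ℝ) ^ α ≤ (((n + 1 : ℕ) : ℝ) ^ (n + 1)) ^ α := by gcongr
      _ = ((n + 1 : ℕ) : ℝ) ^ (((n + 1 : ℕ) : ℝ) * α) := by
        rw [Real.rpow_mul (by positivity), Real.rpow_natCast]
      _ ≤ _ := Real.rpow_le_rpow_of_exponent_le hk1 (by nlinarith)
  calc M ^ (n + 1) * catalan n * ((n + 1).factorial : ℝ) ^ α
      ≤ M ^ (n + 1) * 4 ^ (n + 1) * ((n + 1 : ℕ) : ℝ) ^ ((α + 1 / 2) * ((n + 1 : ℕ) : ℝ)) := by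
        gcongr
    _ = _ := by rw [mul_pow]; ring
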